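/- Let f be a bounded, twice continuously differentiable function on [0,∞) with bounded continuous derivatives up to second order, which is nonnegative, concave and nondecreasing; let φ be a bounded, twice continuously differentiable function on [0,∞) with bounded continuous derivatives up to second order, which is nonnegative and nonincreasing. Define F(x,y) = φ(x) f(x−y) 1_{x≠y} on D. Then F belongs to the domain of the coupling generator L̃, and for every (x,y) ∈ Δᶜ: L̃F(x,y) ≤ c y φ(x) f″(x−y) + [β − bx − g(x)]φ′(x)f(x−y) + yφ(x)[f(2(x−y)) − 2f(x−y)]·μ_{x−y}((0,∞)) + φ(x)[f(2(x−y)) − 2f(x−y)]·ν_{x−y}((0,∞)) + Ã₁F(x,y) + Ã₂F(x,y), where Ã₁F(x,y) = f(x−y)·[ c x φ″(x) − y∫₀^∞(φ(x+z) − φ(x))μ_{y−x}(dz) + x∫₀^∞(φ(x+z) − φ(x) − φ′(x)z1_{z≤1})μ(dz) + ∫₀^∞(φ(x+z) − φ(x))(ν − ν_{y−x})(dz) ] and Ã₂F(x,y) = (x−y)φ(x)·[ c f″(x−y) − b f′(x−y) + ∫₀^∞(f(x−y+z) − f(x−y) − f′(x−y)z1_{z≤1})μ(dz) ]. -/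

import Mathlib

open MeasureTheory

/-- For a σ-finite Borel measure `m` on `ℝ` vanishing on `(-∞,0]` and `x ∈ ℝ`,
`mShift m x = ½ (m ∧ T_x m)` where `T_x m` is the image of `m` under `z ↦ z + x`
and `∧` is the infimum in the lattice of measures. -/
noncomputable def mShift (m : Measure ℝ) (x : ℝ) : Measure ℝ :=
  (2⁻¹ : ENNReal) • (m ⊓ Measure.map (fun z => z + x) m)

/-- First partial derivative of `F` in the first variable. -/
noncomputable def Fx (F : ℝ → ℝ → ℝ) (x y : ℝ) : ℝ := deriv (fun t => F t y) x

/-- First partial derivative of `F` in the second variable. -/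
noncomputable def Fy (F : ℝ → ℝ → ℝ) (x y : ℝ) : ℝ := deriv (fun t => F x t) y

/-- Second partial derivative `F″_{xx}`. -/
noncomputable def Fxx (F : ℝ → ℝ → ℝ) (x y : ℝ) : ℝ := deriv (fun t => Fx F t y) x

/-- Second partial derivative `F″_{yy}`. -/
noncomputable def Fyy (F : ℝ → ℝ → ℝ) (x y : ℝ) : ℝ := deriv (fun t => Fy F x t) y

/-- Mixed second partial derivative `F″_{xy}`. -/
noncomputable def Fxy (F : ℝ → ℝ → ℝ) (x y : ℝ) : ℝ := deriv (fun t => Fx F x t) y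

/-- `cutoff z = z 1_{z ≤ 1}`. -/
noncomputable def cutoff (z : ℝ) : ℝ := if z ≤ 1 then z else 0

/-- The part `L̃₀` of the coupling generator. -/
noncomputable def Ltil0 (b c β : ℝ) (g : ℝ → ℝ) (μ ν : Measure ℝ)
    (F : ℝ → ℝ → ℝ) (x y : ℝ) : ℝ :=
  (β - b * x - g x) * Fx F x y + (β - b * y - g y) * Fy F x y
    + c * x * Fxx F x y + c * y * Fyy F x y - 2 * c * y * Fxy F x y
    + (∫ z in Set.Ioi (0 : ℝ), (F (x + z) (y + z) - F x y) ∂ν)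
    + (x - y) * (∫ z in Set.Ioi (0 : ℝ), (F (x + z) y - F x y - Fx F x y * cutoff z) ∂μ)
    + y * (∫ z in Set.Ioi (0 : ℝ),
        (F (x + z) (y + z) - F x y - (Fx F x y + Fy F x y) * cutoff z) ∂μ)

/-- The part `L̃₁` of the coupling generator (induced by the lassoing process). -/
noncomputable def Ltil1 (μ ν : Measure ℝ) (F : ℝ → ℝ → ℝ) (x y : ℝ) : ℝ :=
  y * (∫ z in Set.Ioi (0 : ℝ), (F (x + z) (2 * y + z - x) - F (x + z) (y + z)) ∂(mShift μ (x - y)))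
    + y * (∫ z in Set.Ioi (0 : ℝ), (F (x + z) (x + z) - F (x + z) (y + z)) ∂(mShift μ (y - x)))
    + (∫ z in Set.Ioi (0 : ℝ), (F (x + z) (2 * y + z - x) - F (x + z) (y + z)) ∂(mShift ν (x - y)))
    + (∫ z in Set.Ioi (0 : ℝ), (F (x + z) (x + z) - F (x + z) (y + z)) ∂(mShift ν (y - x)))

/-- The coupling generator `L̃ = L̃₀ + L̃₁`. -/
noncomputable def Ltil (b c β : ℝ) (g : ℝ → ℝ) (μ ν : Measure ℝ)
    (F : ℝ → ℝ → ℝ) (x y : ℝ) : ℝ :=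
  Ltil0 b c β g μ ν F x y + Ltil1 μ ν F x y

/-- `Δᶜ = D ∖ Δ = {(x,y) : 0 ≤ y < x}`. -/
def DeltaC : Set (ℝ × ℝ) := {p | 0 ≤ p.2 ∧ p.2 < p.1}

/-- `F` belongs to the domain of the coupling generator `L̃`: all the integrals
appearing in `L̃₀F` and `L̃₁F` converge at each point of `Δᶜ`, and `L̃F` is
bounded on compact subsets of `Δᶜ`. -/
def InDomLtil (b c β : ℝ) (g : ℝ → ℝ) (μ ν : Measure ℝ) (F : ℝ → ℝ → ℝ) : Prop :=
  (∀ x y : ℝ, 0 ≤ y → y < x →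
    MeasureTheory.IntegrableOn (fun z => F (x + z) (y + z) - F x y) (Set.Ioi 0) ν ∧
    MeasureTheory.IntegrableOn (fun z => F (x + z) y - F x y - Fx F x y * cutoff z)
      (Set.Ioi 0) μ ∧
    MeasureTheory.IntegrableOn
      (fun z => F (x + z) (y + z) - F x y - (Fx F x y + Fy F x y) * cutoff z) (Set.Ioi 0) μ ∧
    MeasureTheory.IntegrableOn (fun z => F (x + z) (2 * y + z - x) - F (x + z) (y + z))
      (Set.Ioi 0) (mShift μ (x - y)) ∧
    MeasureTheory.IntegrableOn (fun z => F (x + z) (x + z) - F (x + z) (y + z))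
      (Set.Ioi 0) (mShift μ (y - x)) ∧
    MeasureTheory.IntegrableOn (fun z => F (x + z) (2 * y + z - x) - F (x + z) (y + z))
      (Set.Ioi 0) (mShift ν (x - y)) ∧
    MeasureTheory.IntegrableOn (fun z => F (x + z) (x + z) - F (x + z) (y + z))
      (Set.Ioi 0) (mShift ν (y - x))) ∧
  (∀ K : Set (ℝ × ℝ), K ⊆ DeltaC → IsCompact K →
    ∃ M : ℝ, ∀ p ∈ K, |Ltil b c β g μ ν F p.1 p.2| ≤ M)

section CouplingEstimate

open Set Filter Topology

/-! ### First and second order increments of functions with bounded derivatives -/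

theorem abs_increment_le_mul {h : ℝ → ℝ} (hh : Differentiable ℝ h) {C a z : ℝ} (ha : 0 ≤ a)
    (hz : 0 ≤ z) (hC : ∀ t, 0 ≤ t → t ≤ a + z → |deriv h t| ≤ C) :
    |h (a + z) - h a| ≤ C * z := by
  have key := (convex_Icc (0 : ℝ) (a + z)).norm_image_sub_le_of_norm_deriv_le (f := h) (C := C)
    (x := a) (y := a + z) (fun t _ => hh t) (fun t ht => hC t ht.1 ht.2)
    ⟨ha, by linarith⟩ ⟨by linarith, le_rfl⟩
  simpa [Real.norm_eq_abs, abs_of_nonneg hz] using key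

theorem abs_increment_le {h : ℝ → ℝ} (hh : Differentiable ℝ h) {M : ℝ}
    (hM0 : ∀ t, 0 ≤ t → |h t| ≤ M) (hM1 : ∀ t, 0 ≤ t → |deriv h t| ≤ M) {a z : ℝ}
    (ha : 0 ≤ a) (hz : 0 < z) : |h (a + z) - h a| ≤ 2 * M * min 1 z := by
  have hM : 0 ≤ M := (abs_nonneg _).trans (hM0 0 le_rfl)
  rcases le_total 1 z with h1 | h1
  · rw [min_eq_left h1]
    have := abs_sub (h (a + z)) (h a)
    linarith [hM0 a ha, hM0 (a + z) (by linarith)]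
  · rw [min_eq_right h1]
    have := abs_increment_le_mul hh ha hz.le fun t ht _ => hM1 t ht
    nlinarith

theorem abs_compensated_increment_le {h : ℝ → ℝ} (hh : ContDiff ℝ 2 h) {M : ℝ}
    (hM0 : ∀ t, 0 ≤ t → |h t| ≤ M) (hM2 : ∀ t, 0 ≤ t → |deriv (deriv h) t| ≤ M) {a z : ℝ}
    (ha : 0 ≤ a) (hz : 0 < z) :
    |h (a + z) - h a - deriv h a * cutoff z| ≤ 2 * M * min 1 (z ^ 2) := by
  have hM : 0 ≤ M := (abs_nonneg _).trans (hM0 0 le_rfl)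
  have hd : Differentiable ℝ h := hh.differentiable (by norm_num)
  have hd' : Differentiable ℝ (deriv h) := hh.differentiable_deriv_two
  rcases le_or_gt z 1 with h1 | h1
  · have hz2 : z ^ 2 ≤ 1 := by nlinarith
    rw [min_eq_right hz2, cutoff, if_pos h1]
    have hder : ∀ t, deriv (fun s => h s - deriv h a * s) t = deriv h t - deriv h a := fun t => by
      have := (hd t).hasDerivAt.sub ((hasDerivAt_id t).const_mul (deriv h a))
      exact this.deriv.trans (by rw [mul_one])
    have key := (convex_Icc a (a + z)).norm_image_sub_le_of_norm_deriv_le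
      (f := fun s => h s - deriv h a * s) (C := M * z) (x := a) (y := a + z)
      (fun t _ => by fun_prop) (fun t ht => by
        rw [hder, Real.norm_eq_abs]
        have := abs_increment_le_mul hd' (C := M) (z := t - a) ha (by linarith [ht.1])
          fun s hs _ => hM2 s hs
        rw [add_sub_cancel] at this
        exact this.trans (by nlinarith [ht.2]))
      ⟨le_rfl, by linarith⟩ ⟨by linarith, le_rfl⟩
    have e : h (a + z) - deriv h a * (a + z) - (h a - deriv h a * a)
        = h (a + z) - h a - deriv h a * z := by ring
    rw [e, Real.norm_eq_abs, Real.norm_eq_abs, add_sub_cancel_left, abs_of_pos hz] at key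
    nlinarith
  · have hz2 : 1 ≤ z ^ 2 := by nlinarith
    rw [min_eq_left hz2, cutoff, if_neg (not_le.2 h1)]
    have := abs_sub (h (a + z)) (h a)
    rw [mul_zero, sub_zero]
    linarith [hM0 a ha, hM0 (a + z) (by linarith)]

theorem min_one_mul_min_one {z : ℝ} (hz : 0 < z) : min 1 z * min 1 z = min 1 (z ^ 2) := by
  rcases le_total 1 z with h1 | h1
  · rw [min_eq_left h1, min_eq_left (by nlinarith)]; norm_num
  · rw [min_eq_right h1, min_eq_right (by nlinarith)]; ring

theorem measurable_cutoff : Measurable cutoff :=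
  Measurable.ite measurableSet_Iic measurable_id measurable_const

/-! ### The measures `mShift m x` -/

theorem integrableOn_of_lintegral_ofReal {m : Measure ℝ} {w : ℝ → ℝ} (hw : Measurable w)
    (hw0 : ∀ z, 0 < z → 0 ≤ w z) (h : ∫⁻ z, ENNReal.ofReal (w z) ∂m < ⊤) :
    IntegrableOn w (Ioi 0) m := by
  refine ⟨hw.aestronglyMeasurable, ?_⟩
  rw [hasFiniteIntegral_iff_ofReal ((ae_restrict_iff' measurableSet_Ioi).2 (.of_forall hw0))]
  exact (lintegral_mono' Measure.restrict_le_self le_rfl).trans_lt h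

theorem measure_Ioi_lt_top {m : Measure ℝ} {w : ℝ → ℝ} (hw : IntegrableOn w (Ioi 0) m)
    (hmono : MonotoneOn w (Ioi 0)) {u : ℝ} (hu : 0 < u) (hwu : 0 < w u) : m (Ioi u) < ⊤ := by
  have key := Integrable.measure_ge_lt_top hw hwu
  refine lt_of_le_of_lt ?_ key
  calc m (Ioi u) = m.restrict (Ioi 0) (Ioi u) := by
        rw [Measure.restrict_apply measurableSet_Ioi,
          inter_eq_left.2 (Ioi_subset_Ioi hu.le)]
    _ ≤ _ := measure_mono fun z hz => hmono hu (hu.trans hz) (le_of_lt hz)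

theorem mShift_le_inf (m : Measure ℝ) (x : ℝ) :
    mShift m x ≤ m ⊓ Measure.map (fun z => z + x) m := by
  intro s
  rw [mShift, Measure.smul_apply, smul_eq_mul]
  exact mul_le_of_le_one_left' (by simp)

theorem mShift_le (m : Measure ℝ) (x : ℝ) : mShift m x ≤ m :=
  (mShift_le_inf m x).trans inf_le_left

theorem mShift_le_map (m : Measure ℝ) (x : ℝ) : mShift m x ≤ Measure.map (fun z => z + x) m :=
  (mShift_le_inf m x).trans inf_le_right

theorem mShift_univ_le {m : Measure ℝ} (hm : m (Iic 0) = 0) {u : ℝ} :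
    mShift m u univ ≤ m (Ioi u) := by
  rw [← measure_add_measure_compl (s := Iic u) measurableSet_Iic, compl_Iic]
  have h1 : mShift m u (Iic u) ≤ 0 := (mShift_le_map m u _).trans (by
    rw [Measure.map_apply (by fun_prop) measurableSet_Iic]
    have : (fun z => z + u) ⁻¹' Iic u = Iic 0 := by ext z; simp
    rw [this, hm])
  calc _ ≤ 0 + m (Ioi u) := add_le_add h1 (mShift_le m u _)
    _ = _ := zero_add _

theorem mShift_neg_univ_le {m : Measure ℝ} (hm : m (Iic 0) = 0) {u : ℝ} :
    mShift m (-u) univ ≤ m (Ioi u) := by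
  rw [← measure_add_measure_compl (s := Iic 0) measurableSet_Iic, compl_Iic]
  have h1 : mShift m (-u) (Iic 0) ≤ 0 := (mShift_le m _ _).trans hm.le
  have h2 : mShift m (-u) (Ioi 0) ≤ m (Ioi u) := (mShift_le_map m _ _).trans (by
    rw [Measure.map_apply (by fun_prop) measurableSet_Ioi]
    refine measure_mono fun z hz => ?_
    simpa using hz)
  calc _ ≤ 0 + m (Ioi u) := add_le_add h1 h2
    _ = _ := zero_add _

theorem map_mShift_le (m : Measure ℝ) (u : ℝ) :
    Measure.map (fun z => z + -u) (mShift m u) ≤ mShift m (-u) := by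
  have hmeas : Measurable fun z : ℝ => z + -u := by fun_prop
  rw [mShift, mShift, Measure.map_smul]
  have h : Measure.map (fun z => z + -u) (m ⊓ Measure.map (fun z => z + u) m)
      ≤ m ⊓ Measure.map (fun z => z + -u) m := by
    refine le_inf ?_ (Measure.map_mono inf_le_left hmeas)
    refine (Measure.map_mono inf_le_right hmeas).trans (le_of_eq ?_)
    rw [Measure.map_map hmeas (by fun_prop)]
    have : ((fun z : ℝ => z + -u) ∘ fun z => z + u) = id := by ext z; simp
    rw [this, Measure.map_id]
  intro s
  simp only [Measure.smul_apply, smul_eq_mul]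
  gcongr

theorem mShift_Ioi_le {m : Measure ℝ} (hm : m (Iic 0) = 0) (u : ℝ) :
    mShift m u (Ioi 0) ≤ mShift m (-u) (Ioi 0) := by
  have h0 : mShift m (-u) (Iic 0) = 0 := le_antisymm ((mShift_le m _ _).trans hm.le) bot_le
  calc mShift m u (Ioi 0) ≤ mShift m u univ := measure_mono (subset_univ _)
    _ = Measure.map (fun z => z + -u) (mShift m u) univ := by
        rw [Measure.map_apply (by fun_prop) MeasurableSet.univ, preimage_univ]
    _ ≤ mShift m (-u) univ := map_mShift_le m u _
    _ = mShift m (-u) (Ioi 0) := by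
        rw [← measure_add_measure_compl (s := Iic 0) measurableSet_Iic, compl_Iic, h0, zero_add]

/-! ### Partial derivatives of `φ(x) f(x - y)` off the diagonal -/

section Derivatives

variable {f φ : ℝ → ℝ} {F : ℝ → ℝ → ℝ}

theorem Fx_eq (hf : Differentiable ℝ f) (hφ : Differentiable ℝ φ)
    (hF : F = fun x y => if x = y then 0 else φ x * f (x - y)) {x y : ℝ} (hxy : x ≠ y) :
    Fx F x y = deriv φ x * f (x - y) + φ x * deriv f (x - y) := by
  have e : (fun t => F t y) =ᶠ[𝓝 x] fun t => φ t * f (t - y) := by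
    filter_upwards [isOpen_ne.mem_nhds hxy] with t ht
    rw [hF]; exact if_neg ht
  rw [Fx, e.deriv_eq]
  have := (hφ x).hasDerivAt.mul ((hf (x - y)).hasDerivAt.comp_sub_const x y)
  exact this.deriv

theorem Fy_eq (hf : Differentiable ℝ f)
    (hF : F = fun x y => if x = y then 0 else φ x * f (x - y)) {x y : ℝ} (hxy : x ≠ y) :
    Fy F x y = -(φ x * deriv f (x - y)) := by
  have e : (fun t => F x t) =ᶠ[𝓝 y] fun t => φ x * f (x - t) := by
    filter_upwards [isOpen_ne.mem_nhds hxy.symm] with t ht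
    rw [hF]; exact if_neg (Ne.symm ht)
  rw [Fy, e.deriv_eq]
  have := ((hf (x - y)).hasDerivAt.comp_const_sub x y).const_mul (φ x)
  exact this.deriv.trans (by ring)

theorem Fxx_eq (hf : ContDiff ℝ 2 f) (hφ : ContDiff ℝ 2 φ)
    (hF : F = fun x y => if x = y then 0 else φ x * f (x - y)) {x y : ℝ} (hxy : x ≠ y) :
    Fxx F x y = deriv (deriv φ) x * f (x - y) + 2 * (deriv φ x * deriv f (x - y))
      + φ x * deriv (deriv f) (x - y) := by
  have hf1 : Differentiable ℝ f := hf.differentiable (by norm_num)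
  have hφ1 : Differentiable ℝ φ := hφ.differentiable (by norm_num)
  have e : (fun t => Fx F t y) =ᶠ[𝓝 x] fun t => deriv φ t * f (t - y) + φ t * deriv f (t - y) := by
    filter_upwards [isOpen_ne.mem_nhds hxy] with t ht using Fx_eq hf1 hφ1 hF ht
  rw [Fxx, e.deriv_eq]
  have := ((hφ.differentiable_deriv_two x).hasDerivAt.mul
    ((hf1 (x - y)).hasDerivAt.comp_sub_const x y)).add ((hφ1 x).hasDerivAt.mul
    ((hf.differentiable_deriv_two (x - y)).hasDerivAt.comp_sub_const x y))
  refine this.deriv.trans ?_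
  ring

theorem Fyy_eq (hf : ContDiff ℝ 2 f)
    (hF : F = fun x y => if x = y then 0 else φ x * f (x - y)) {x y : ℝ} (hxy : x ≠ y) :
    Fyy F x y = φ x * deriv (deriv f) (x - y) := by
  have hf1 : Differentiable ℝ f := hf.differentiable (by norm_num)
  have e : (fun t => Fy F x t) =ᶠ[𝓝 y] fun t => -(φ x * deriv f (x - t)) := by
    filter_upwards [isOpen_ne.mem_nhds hxy.symm] with t ht using Fy_eq hf1 hF (Ne.symm ht)
  rw [Fyy, e.deriv_eq]
  have := (((hf.differentiable_deriv_two (x - y)).hasDerivAt.comp_const_sub x y).const_mul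
    (φ x)).neg
  refine this.deriv.trans ?_
  ring

theorem Fxy_eq (hf : ContDiff ℝ 2 f) (hφ : Differentiable ℝ φ)
    (hF : F = fun x y => if x = y then 0 else φ x * f (x - y)) {x y : ℝ} (hxy : x ≠ y) :
    Fxy F x y = -(deriv φ x * deriv f (x - y)) - φ x * deriv (deriv f) (x - y) := by
  have hf1 : Differentiable ℝ f := hf.differentiable (by norm_num)
  have e : (fun t => Fx F x t) =ᶠ[𝓝 y] fun t => deriv φ x * f (x - t) + φ x * deriv f (x - t) := by
    filter_upwards [isOpen_ne.mem_nhds hxy.symm] with t ht using Fx_eq hf1 hφ hF (Ne.symm ht)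
  rw [Fxy, e.deriv_eq]
  have := (((hf1 (x - y)).hasDerivAt.comp_const_sub x y).const_mul (deriv φ x)).add
    (((hf.differentiable_deriv_two (x - y)).hasDerivAt.comp_const_sub x y).const_mul (φ x))
  refine this.deriv.trans ?_
  ring

end Derivatives

theorem deriv_nonneg_of_monotoneOn_Ici {h : ℝ → ℝ} (hh : MonotoneOn h (Ici 0)) {u : ℝ}
    (hu : 0 < u) : 0 ≤ deriv h u := by
  rw [← derivWithin_of_mem_nhds (Ici_mem_nhds hu)]
  exact hh.derivWithin_nonneg

theorem deriv_nonpos_of_antitoneOn_Ici {h : ℝ → ℝ} (hh : AntitoneOn h (Ici 0)) {u : ℝ}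
    (hu : 0 < u) : deriv h u ≤ 0 := by
  rw [← derivWithin_of_mem_nhds (Ici_mem_nhds hu)]
  exact hh.derivWithin_nonpos

/-! ### Integrability and integral bounds -/

theorem integrableOn_of_abs_le_mul {m : Measure ℝ} {w h : ℝ → ℝ} {C : ℝ}
    (hw : IntegrableOn w (Ioi 0) m) (hh : Measurable h) (hC : ∀ z, 0 < z → |h z| ≤ C * w z) :
    IntegrableOn h (Ioi 0) m :=
  Integrable.mono' (hw.const_mul C) hh.aestronglyMeasurable
    ((ae_restrict_iff' measurableSet_Ioi).2 (.of_forall hC))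

theorem abs_setIntegral_le_mul {m : Measure ℝ} {w h : ℝ → ℝ} {C : ℝ}
    (hw : IntegrableOn w (Ioi 0) m) (hC : ∀ z, 0 < z → |h z| ≤ C * w z) :
    |∫ z in Ioi 0, h z ∂m| ≤ C * ∫ z in Ioi 0, w z ∂m := by
  rw [← integral_const_mul]
  exact norm_integral_le_of_norm_le (f := h) (hw.const_mul C)
    ((ae_restrict_iff' measurableSet_Ioi).2 (.of_forall hC))

/-- `h` is twice continuously differentiable and `h`, `h'`, `h''` are bounded by `M` on `[0,∞)`. -/
structure BoundedCTwo (h : ℝ → ℝ) (M : ℝ) : Prop where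
  contDiff : ContDiff ℝ 2 h
  abs_le : ∀ t, 0 ≤ t → |h t| ≤ M
  abs_deriv_le : ∀ t, 0 ≤ t → |deriv h t| ≤ M
  abs_deriv_deriv_le : ∀ t, 0 ≤ t → |deriv (deriv h) t| ≤ M

theorem BoundedCTwo.of_exists {h : ℝ → ℝ} (hh : ContDiff ℝ 2 h)
    (hb : ∃ M : ℝ, ∀ x ∈ Ici (0 : ℝ), |h x| + |deriv h x| + |deriv (deriv h) x| ≤ M) :
    ∃ M, BoundedCTwo h M := by
  obtain ⟨M, hM⟩ := hb
  refine ⟨M, hh, fun t ht => ?_, fun t ht => ?_, fun t ht => ?_⟩ <;>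
  linarith [hM t ht, abs_nonneg (h t), abs_nonneg (deriv h t), abs_nonneg (deriv (deriv h) t)]

theorem BoundedCTwo.differentiable {h : ℝ → ℝ} {M : ℝ} (hh : BoundedCTwo h M) :
    Differentiable ℝ h := hh.contDiff.differentiable (by norm_num)

theorem BoundedCTwo.nonneg {h : ℝ → ℝ} {M : ℝ} (hh : BoundedCTwo h M) : 0 ≤ M :=
  (abs_nonneg _).trans (hh.abs_le 0 le_rfl)

theorem BoundedCTwo.integrableOn_shift {h : ℝ → ℝ} {M : ℝ} (hh : BoundedCTwo h M)
    {m : Measure ℝ} [IsFiniteMeasure m] {a : ℝ} (ha : 0 ≤ a) :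
    IntegrableOn (fun z => h (a + z)) (Ioi 0) m :=
  integrableOn_of_abs_le_mul (w := fun _ => 1) (C := M) (integrable_const _)
    (hh.contDiff.continuous.measurable.comp (measurable_const_add a))
    fun z hz => by simpa using hh.abs_le (a + z) (by linarith)

theorem BoundedCTwo.integrableOn_increment {h : ℝ → ℝ} {M : ℝ} (hh : BoundedCTwo h M)
    {m : Measure ℝ} (hm : IntegrableOn (fun z => min 1 z) (Ioi 0) m) {a : ℝ} (ha : 0 ≤ a) :
    IntegrableOn (fun z => h (a + z) - h a) (Ioi 0) m :=
  integrableOn_of_abs_le_mul hm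
    ((hh.contDiff.continuous.measurable.comp (measurable_const_add a)).sub_const _)
    fun _ hz => abs_increment_le hh.differentiable hh.abs_le hh.abs_deriv_le ha hz

theorem BoundedCTwo.integrableOn_compensated {h : ℝ → ℝ} {M : ℝ} (hh : BoundedCTwo h M)
    {m : Measure ℝ} (hm : IntegrableOn (fun z => min 1 (z ^ 2)) (Ioi 0) m) {a : ℝ} (ha : 0 ≤ a) :
    IntegrableOn (fun z => h (a + z) - h a - deriv h a * cutoff z) (Ioi 0) m :=
  integrableOn_of_abs_le_mul hm
    (((hh.contDiff.continuous.measurable.comp (measurable_const_add a)).sub_const _).sub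
      (measurable_cutoff.const_mul _))
    fun _ hz => abs_compensated_increment_le hh.contDiff hh.abs_le hh.abs_deriv_deriv_le ha hz

theorem product_increment_eq (φ f : ℝ → ℝ) (x u z : ℝ) :
    φ (x + z) * f (u + z) - φ x * f u - (deriv φ x * f u + φ x * deriv f u) * cutoff z
      = f u * (φ (x + z) - φ x - deriv φ x * cutoff z)
        + φ x * (f (u + z) - f u - deriv f u * cutoff z)
        + (φ (x + z) - φ x) * (f (u + z) - f u) := by
  ring

theorem abs_product_increment_le {φ f : ℝ → ℝ} {M N : ℝ} (hφ : BoundedCTwo φ M)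
    (hf : BoundedCTwo f N) {x u z : ℝ} (hx : 0 ≤ x) (hu : 0 ≤ u) (hz : 0 < z) :
    |φ (x + z) * f (u + z) - φ x * f u - (deriv φ x * f u + φ x * deriv f u) * cutoff z|
      ≤ 8 * M * N * min 1 (z ^ 2) := by
  have hM := hφ.nonneg
  have hN := hf.nonneg
  rw [product_increment_eq]
  have h1 := abs_compensated_increment_le hφ.contDiff hφ.abs_le hφ.abs_deriv_deriv_le hx hz
  have h2 := abs_compensated_increment_le hf.contDiff hf.abs_le hf.abs_deriv_deriv_le hu hz
  have h3 := abs_increment_le hφ.differentiable hφ.abs_le hφ.abs_deriv_le hx hz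
  have h4 := abs_increment_le hf.differentiable hf.abs_le hf.abs_deriv_le hu hz
  have hmin : 0 < min 1 z := lt_min one_pos hz
  calc _ ≤ |f u| * |φ (x + z) - φ x - deriv φ x * cutoff z|
        + |φ x| * |f (u + z) - f u - deriv f u * cutoff z|
        + |φ (x + z) - φ x| * |f (u + z) - f u| := by
        simp only [← abs_mul]; exact abs_add_three _ _ _
    _ ≤ N * (2 * M * min 1 (z ^ 2)) + M * (2 * N * min 1 (z ^ 2))
        + (2 * M * min 1 z) * (2 * N * min 1 z) := by
        gcongr
        · exact hf.abs_le u hu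
        · exact hφ.abs_le x hx
    _ = 4 * M * N * min 1 (z ^ 2) + 4 * M * N * (min 1 z * min 1 z) := by ring
    _ = _ := by rw [min_one_mul_min_one hz]; ring

theorem integrableOn_product_increment {φ f : ℝ → ℝ} {M N : ℝ} (hφ : BoundedCTwo φ M)
    (hf : BoundedCTwo f N) {m : Measure ℝ} (hm : IntegrableOn (fun z => min 1 (z ^ 2)) (Ioi 0) m)
    {x u : ℝ} (hx : 0 ≤ x) (hu : 0 ≤ u) :
    IntegrableOn (fun z => φ (x + z) * f (u + z) - φ x * f u
      - (deriv φ x * f u + φ x * deriv f u) * cutoff z) (Ioi 0) m := by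
  refine integrableOn_of_abs_le_mul hm ?_ fun z hz => abs_product_increment_le hφ hf hx hu hz
  have h1 := hφ.contDiff.continuous.measurable
  have h2 := hf.contDiff.continuous.measurable
  have h3 := measurable_cutoff
  fun_prop

/-! ### The generator applied to `φ(x) f(x - y)` -/

section Explicit

variable {f φ : ℝ → ℝ} {F : ℝ → ℝ → ℝ}

theorem F_shift_eq (hF : F = fun x y => if x = y then 0 else φ x * f (x - y)) {x y : ℝ}
    (hxy : y < x) (z : ℝ) : F (x + z) (y + z) = φ (x + z) * f (x - y) := by
  subst hF
  simp only [add_sub_add_right_eq_sub]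
  rw [if_neg (by linarith [·])]

theorem F_lasso_eq (hF : F = fun x y => if x = y then 0 else φ x * f (x - y)) {x y : ℝ}
    (hxy : y < x) (z : ℝ) :
    F (x + z) (2 * y + z - x) = φ (x + z) * f (2 * (x - y)) := by
  subst hF
  have e : x + z - (2 * y + z - x) = 2 * (x - y) := by ring
  simp only [e]
  rw [if_neg (by intro h; linarith)]

theorem F_first_eq (hF : F = fun x y => if x = y then 0 else φ x * f (x - y)) {x y z : ℝ}
    (hxy : y < x) (hz : 0 ≤ z) : F (x + z) y = φ (x + z) * f (x - y + z) := by
  subst hF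
  have e : x + z - y = x - y + z := by ring
  simp only [e]
  rw [if_neg (by intro h; linarith)]

theorem F_diag_eq (hF : F = fun x y => if x = y then 0 else φ x * f (x - y)) (t : ℝ) :
    F t t = 0 := by
  subst hF; simp

theorem F_eq (hF : F = fun x y => if x = y then 0 else φ x * f (x - y)) {x y : ℝ}
    (hxy : y < x) : F x y = φ x * f (x - y) := by
  subst hF; exact if_neg hxy.ne'

theorem Ltil_eq {b c β : ℝ} {g : ℝ → ℝ} {μ ν : Measure ℝ} (hf : ContDiff ℝ 2 f)
    (hφ : ContDiff ℝ 2 φ) (hF : F = fun x y => if x = y then 0 else φ x * f (x - y)) {x y : ℝ}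
    (hxy : y < x) :
    Ltil b c β g μ ν F x y =
      (β - b * x - g x) * (deriv φ x * f (x - y) + φ x * deriv f (x - y))
      - (β - b * y - g y) * (φ x * deriv f (x - y))
      + c * x * (deriv (deriv φ) x * f (x - y) + 2 * (deriv φ x * deriv f (x - y))
        + φ x * deriv (deriv f) (x - y))
      + c * y * (φ x * deriv (deriv f) (x - y))
      + 2 * c * y * (deriv φ x * deriv f (x - y) + φ x * deriv (deriv f) (x - y))
      + f (x - y) * (∫ z in Ioi (0 : ℝ), (φ (x + z) - φ x) ∂ν)
      + (x - y) * (∫ z in Ioi (0 : ℝ), (φ (x + z) * f (x - y + z) - φ x * f (x - y)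
          - (deriv φ x * f (x - y) + φ x * deriv f (x - y)) * cutoff z) ∂μ)
      + y * (f (x - y) * ∫ z in Ioi (0 : ℝ), (φ (x + z) - φ x - deriv φ x * cutoff z) ∂μ)
      + y * ((f (2 * (x - y)) - f (x - y)) * ∫ z in Ioi (0 : ℝ), φ (x + z) ∂(mShift μ (x - y)))
      - y * (f (x - y) * ∫ z in Ioi (0 : ℝ), φ (x + z) ∂(mShift μ (y - x)))
      + (f (2 * (x - y)) - f (x - y)) * (∫ z in Ioi (0 : ℝ), φ (x + z) ∂(mShift ν (x - y)))
      - f (x - y) * (∫ z in Ioi (0 : ℝ), φ (x + z) ∂(mShift ν (y - x))) := by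
  have hf1 : Differentiable ℝ f := hf.differentiable (by norm_num)
  have hφ1 : Differentiable ℝ φ := hφ.differentiable (by norm_num)
  have lasso : ∀ m : Measure ℝ,
      ∫ z in Ioi (0 : ℝ), (F (x + z) (2 * y + z - x) - F (x + z) (y + z)) ∂m
        = (f (2 * (x - y)) - f (x - y)) * ∫ z in Ioi (0 : ℝ), φ (x + z) ∂m := fun m => by
    rw [← integral_const_mul]
    congr 1; ext z
    rw [F_lasso_eq hF hxy, F_shift_eq hF hxy]; ring
  have merge : ∀ m : Measure ℝ,
      ∫ z in Ioi (0 : ℝ), (F (x + z) (x + z) - F (x + z) (y + z)) ∂m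
        = -(f (x - y) * ∫ z in Ioi (0 : ℝ), φ (x + z) ∂m) := fun m => by
    rw [← neg_mul, ← integral_const_mul]
    congr 1; ext z
    rw [F_diag_eq hF, F_shift_eq hF hxy]; ring
  have first : ∫ z in Ioi (0 : ℝ), (F (x + z) y - F x y - Fx F x y * cutoff z) ∂μ
      = ∫ z in Ioi (0 : ℝ), (φ (x + z) * f (x - y + z) - φ x * f (x - y)
          - (deriv φ x * f (x - y) + φ x * deriv f (x - y)) * cutoff z) ∂μ :=
    setIntegral_congr_fun measurableSet_Ioi fun z hz => by
      rw [F_first_eq hF hxy (le_of_lt hz), F_eq hF hxy, Fx_eq hf1 hφ1 hF hxy.ne']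
  have shift : ∫ z in Ioi (0 : ℝ),
      (F (x + z) (y + z) - F x y - (Fx F x y + Fy F x y) * cutoff z) ∂μ
      = f (x - y) * ∫ z in Ioi (0 : ℝ), (φ (x + z) - φ x - deriv φ x * cutoff z) ∂μ := by
    rw [← integral_const_mul]
    congr 1; ext z
    rw [F_shift_eq hF hxy, F_eq hF hxy, Fx_eq hf1 hφ1 hF hxy.ne', Fy_eq hf1 hF hxy.ne']; ring
  have imm : ∫ z in Ioi (0 : ℝ), (F (x + z) (y + z) - F x y) ∂ν
      = f (x - y) * ∫ z in Ioi (0 : ℝ), (φ (x + z) - φ x) ∂ν := by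
    rw [← integral_const_mul]
    congr 1; ext z
    rw [F_shift_eq hF hxy, F_eq hF hxy]; ring
  rw [Ltil, Ltil0, Ltil1, first, shift, imm, lasso, lasso, merge, merge, Fx_eq hf1 hφ1 hF hxy.ne',
    Fy_eq hf1 hF hxy.ne', Fxx_eq hf hφ hF hxy.ne', Fyy_eq hf hF hxy.ne', Fxy_eq hf hφ1 hF hxy.ne']
  ring

end Explicit

/-! ### Functions bounded on a set -/

/-- `h` is bounded on `K`. -/
def AbsBddOn (K : Set (ℝ × ℝ)) (h : ℝ × ℝ → ℝ) : Prop := ∃ M : ℝ, ∀ p ∈ K, |h p| ≤ M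

namespace AbsBddOn

variable {K : Set (ℝ × ℝ)} {h k : ℝ × ℝ → ℝ}

theorem const (a : ℝ) : AbsBddOn K fun _ => a := ⟨|a|, fun _ _ => le_rfl⟩

theorem add (hh : AbsBddOn K h) (hk : AbsBddOn K k) : AbsBddOn K fun p => h p + k p := by
  obtain ⟨M, hM⟩ := hh
  obtain ⟨N, hN⟩ := hk
  exact ⟨M + N, fun p hp => (abs_add_le _ _).trans (add_le_add (hM p hp) (hN p hp))⟩

theorem sub (hh : AbsBddOn K h) (hk : AbsBddOn K k) : AbsBddOn K fun p => h p - k p := by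
  obtain ⟨M, hM⟩ := hh
  obtain ⟨N, hN⟩ := hk
  exact ⟨M + N, fun p hp => (abs_sub _ _).trans (add_le_add (hM p hp) (hN p hp))⟩

theorem mul (hh : AbsBddOn K h) (hk : AbsBddOn K k) : AbsBddOn K fun p => h p * k p := by
  obtain ⟨M, hM⟩ := hh
  obtain ⟨N, hN⟩ := hk
  refine ⟨M * N, fun p hp => ?_⟩
  rw [abs_mul]
  exact mul_le_mul (hM p hp) (hN p hp) (abs_nonneg _) ((abs_nonneg _).trans (hM p hp))

end AbsBddOn

theorem exists_pos_le_sub_of_isCompact {K : Set (ℝ × ℝ)} (hK : K ⊆ DeltaC) (hc : IsCompact K) :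
    ∃ δ : ℝ, 0 < δ ∧ ∀ p ∈ K, δ ≤ p.1 - p.2 := by
  rcases K.eq_empty_or_nonempty with rfl | hne
  · exact ⟨1, one_pos, by simp⟩
  · obtain ⟨q, hq, hmin⟩ := hc.exists_isMinOn hne (f := fun p : ℝ × ℝ => p.1 - p.2)
      (by fun_prop)
    exact ⟨q.1 - q.2, sub_pos.2 (hK hq).2, fun p hp => hmin hp⟩

theorem absBddOn_setIntegral_shift {K : Set (ℝ × ℝ)} {φ : ℝ → ℝ} {M : ℝ} (hφ : BoundedCTwo φ M)
    (hK : K ⊆ DeltaC) {m : ℝ × ℝ → Measure ℝ} {C : ENNReal} (hC : C < ⊤)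
    (hm : ∀ p ∈ K, m p univ ≤ C) :
    AbsBddOn K fun p => ∫ z in Ioi (0 : ℝ), φ (p.1 + z) ∂(m p) := by
  refine ⟨M * C.toReal, fun p hp => ?_⟩
  have hle : m p (Ioi 0) ≤ C := (measure_mono (subset_univ _)).trans (hm p hp)
  have h0 : 0 ≤ p.1 := (hK hp).1.trans (hK hp).2.le
  refine (norm_setIntegral_le_of_norm_le_const (f := fun z => φ (p.1 + z)) (C := M)
    (hle.trans_lt hC) fun z hz => hφ.abs_le (p.1 + z) (add_nonneg h0 (le_of_lt hz))).trans ?_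
  exact mul_le_mul_of_nonneg_left (ENNReal.toReal_mono hC.ne hle) hφ.nonneg

theorem absBddOn_Ltil {b c β : ℝ} {μ ν : Measure ℝ} (hμ0 : μ (Iic 0) = 0) (hν0 : ν (Iic 0) = 0)
    (hμw : IntegrableOn (fun z => min 1 (z ^ 2)) (Ioi 0) μ)
    (hνw : IntegrableOn (fun z => min 1 z) (Ioi 0) ν)
    (hμt : ∀ u, 0 < u → μ (Ioi u) < ⊤) (hνt : ∀ u, 0 < u → ν (Ioi u) < ⊤)
    {g : ℝ → ℝ} (hg : ContinuousOn g (Ici 0)) {f φ : ℝ → ℝ} {M N : ℝ}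
    (hf : BoundedCTwo f N) (hφ : BoundedCTwo φ M) {F : ℝ → ℝ → ℝ}
    (hF : F = fun x y => if x = y then 0 else φ x * f (x - y)) {K : Set (ℝ × ℝ)}
    (hK : K ⊆ DeltaC) (hKc : IsCompact K) :
    AbsBddOn K fun p => Ltil b c β g μ ν F p.1 p.2 := by
  obtain ⟨δ, hδ, hδK⟩ := exists_pos_le_sub_of_isCompact hK hKc
  have pos2 : ∀ p ∈ K, 0 ≤ p.2 := fun p hp => (hK hp).1
  have pos1 : ∀ p ∈ K, 0 ≤ p.1 := fun p hp => (hK hp).1.trans (hK hp).2.le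
  have posd : ∀ p ∈ K, 0 ≤ p.1 - p.2 := fun p hp => sub_nonneg.2 (hK hp).2.le
  have of_cont : ∀ h : ℝ × ℝ → ℝ, ContinuousOn h K → AbsBddOn K h := fun h hh =>
    hKc.exists_bound_of_continuousOn hh
  have x : AbsBddOn K fun p => p.1 := of_cont _ (by fun_prop)
  have y : AbsBddOn K fun p => p.2 := of_cont _ (by fun_prop)
  have gx : AbsBddOn K fun p => g p.1 := of_cont _ (hg.comp (by fun_prop) pos1)
  have gy : AbsBddOn K fun p => g p.2 := of_cont _ (hg.comp (by fun_prop) pos2)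
  have φ0 : AbsBddOn K fun p => φ p.1 := ⟨M, fun p hp => hφ.abs_le _ (pos1 p hp)⟩
  have φ1 : AbsBddOn K fun p => deriv φ p.1 := ⟨M, fun p hp => hφ.abs_deriv_le _ (pos1 p hp)⟩
  have φ2 : AbsBddOn K fun p => deriv (deriv φ) p.1 :=
    ⟨M, fun p hp => hφ.abs_deriv_deriv_le _ (pos1 p hp)⟩
  have f0 : AbsBddOn K fun p => f (p.1 - p.2) := ⟨N, fun p hp => hf.abs_le _ (posd p hp)⟩
  have f1 : AbsBddOn K fun p => deriv f (p.1 - p.2) :=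
    ⟨N, fun p hp => hf.abs_deriv_le _ (posd p hp)⟩
  have f2 : AbsBddOn K fun p => deriv (deriv f) (p.1 - p.2) :=
    ⟨N, fun p hp => hf.abs_deriv_deriv_le _ (posd p hp)⟩
  have fd : AbsBddOn K fun p => f (2 * (p.1 - p.2)) :=
    ⟨N, fun p hp => hf.abs_le _ (by linarith [posd p hp])⟩
  have Iν : AbsBddOn K fun p => ∫ z in Ioi (0 : ℝ), (φ (p.1 + z) - φ p.1) ∂ν :=
    ⟨_, fun p hp => abs_setIntegral_le_mul hνw fun z hz =>
      abs_increment_le hφ.differentiable hφ.abs_le hφ.abs_deriv_le (pos1 p hp) hz⟩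
  have Iμ : AbsBddOn K fun p => ∫ z in Ioi (0 : ℝ),
      (φ (p.1 + z) - φ p.1 - deriv φ p.1 * cutoff z) ∂μ :=
    ⟨_, fun p hp => abs_setIntegral_le_mul hμw fun z hz =>
      abs_compensated_increment_le hφ.contDiff hφ.abs_le hφ.abs_deriv_deriv_le (pos1 p hp) hz⟩
  have Ip : AbsBddOn K fun p => ∫ z in Ioi (0 : ℝ),
      (φ (p.1 + z) * f (p.1 - p.2 + z) - φ p.1 * f (p.1 - p.2)
        - (deriv φ p.1 * f (p.1 - p.2) + φ p.1 * deriv f (p.1 - p.2)) * cutoff z) ∂μ :=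
    ⟨_, fun p hp => abs_setIntegral_le_mul hμw fun z hz =>
      abs_product_increment_le hφ hf (pos1 p hp) (posd p hp) hz⟩
  have S : ∀ m : Measure ℝ, m (Iic 0) = 0 → (∀ u, 0 < u → m (Ioi u) < ⊤) →
      (AbsBddOn K fun p => ∫ z in Ioi (0 : ℝ), φ (p.1 + z) ∂(mShift m (p.1 - p.2))) ∧
      AbsBddOn K fun p => ∫ z in Ioi (0 : ℝ), φ (p.1 + z) ∂(mShift m (p.2 - p.1)) :=
    fun m hm hmt =>
      ⟨absBddOn_setIntegral_shift hφ hK (hmt δ hδ) fun p hp =>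
        (mShift_univ_le hm).trans (measure_mono (Ioi_subset_Ioi (hδK p hp))),
      absBddOn_setIntegral_shift hφ hK (hmt δ hδ) fun p hp => by
        rw [← neg_sub p.1 p.2]
        exact (mShift_neg_univ_le hm).trans (measure_mono (Ioi_subset_Ioi (hδK p hp)))⟩
  obtain ⟨Sμ, Sμ'⟩ := S μ hμ0 hμt
  obtain ⟨Sν, Sν'⟩ := S ν hν0 hνt
  have drift : ∀ {h k : ℝ × ℝ → ℝ}, AbsBddOn K h → AbsBddOn K k →
      AbsBddOn K fun p => β - b * h p - k p := fun hh hk =>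
    (((AbsBddOn.const β).sub ((AbsBddOn.const b).mul hh)).sub hk)
  have key := ((((((((((((drift x gx).mul ((φ1.mul f0).add (φ0.mul f1))).sub
    ((drift y gy).mul (φ0.mul f1))).add
    (((AbsBddOn.const c).mul x).mul
      (((φ2.mul f0).add ((AbsBddOn.const 2).mul (φ1.mul f1))).add (φ0.mul f2)))).add
    (((AbsBddOn.const c).mul y).mul (φ0.mul f2))).add
    (((AbsBddOn.const (2 * c)).mul y).mul ((φ1.mul f1).add (φ0.mul f2)))).add
    (f0.mul Iν)).add ((x.sub y).mul Ip)).add (y.mul (f0.mul Iμ))).add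
    (y.mul ((fd.sub f0).mul Sμ))).sub (y.mul (f0.mul Sμ'))).add ((fd.sub f0).mul Sν)).sub
    (f0.mul Sν')
  obtain ⟨B, hB⟩ := key
  refine ⟨B, fun p hp => ?_⟩
  simp only
  rw [Ltil_eq hf.contDiff hφ.contDiff hF (hK hp).2]
  exact hB p hp

theorem isFiniteMeasure_mShift {m : Measure ℝ} (hm : m (Iic 0) = 0)
    (hmt : ∀ u, 0 < u → m (Ioi u) < ⊤) {u : ℝ} (hu : 0 < u) : IsFiniteMeasure (mShift m u) :=
  ⟨(mShift_univ_le hm).trans_lt (hmt u hu)⟩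

theorem isFiniteMeasure_mShift_neg {m : Measure ℝ} (hm : m (Iic 0) = 0)
    (hmt : ∀ u, 0 < u → m (Ioi u) < ⊤) {u : ℝ} (hu : 0 < u) : IsFiniteMeasure (mShift m (-u)) :=
  ⟨(mShift_neg_univ_le hm).trans_lt (hmt u hu)⟩

theorem inDomLtil_product {b c β : ℝ} {μ ν : Measure ℝ} (hμ0 : μ (Iic 0) = 0)
    (hν0 : ν (Iic 0) = 0) (hμw : IntegrableOn (fun z => min 1 (z ^ 2)) (Ioi 0) μ)
    (hνw : IntegrableOn (fun z => min 1 z) (Ioi 0) ν)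
    (hμt : ∀ u, 0 < u → μ (Ioi u) < ⊤) (hνt : ∀ u, 0 < u → ν (Ioi u) < ⊤)
    {g : ℝ → ℝ} (hg : ContinuousOn g (Ici 0)) {f φ : ℝ → ℝ} {M N : ℝ}
    (hf : BoundedCTwo f N) (hφ : BoundedCTwo φ M) {F : ℝ → ℝ → ℝ}
    (hF : F = fun x y => if x = y then 0 else φ x * f (x - y)) :
    InDomLtil b c β g μ ν F := by
  refine ⟨fun x y hy hxy => ?_, fun K hK hKc =>
    absBddOn_Ltil hμ0 hν0 hμw hνw hμt hνt hg hf hφ hF hK hKc⟩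
  have hx : 0 ≤ x := hy.trans hxy.le
  have hu : 0 < x - y := sub_pos.2 hxy
  have hf1 := hf.differentiable
  have hφ1 := hφ.differentiable
  rw [← neg_sub x y]
  have := isFiniteMeasure_mShift hμ0 hμt hu
  have := isFiniteMeasure_mShift_neg hμ0 hμt hu
  have := isFiniteMeasure_mShift hν0 hνt hu
  have := isFiniteMeasure_mShift_neg hν0 hνt hu
  have lasso : ∀ (m : Measure ℝ) [IsFiniteMeasure m],
      IntegrableOn (fun z => F (x + z) (2 * y + z - x) - F (x + z) (y + z)) (Ioi 0) m := by
    intro m _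
    refine ((hφ.integrableOn_shift hx).const_mul (f (2 * (x - y)) - f (x - y))).congr
      (.of_forall fun z => ?_)
    simp only
    rw [F_lasso_eq hF hxy, F_shift_eq hF hxy]; ring
  have merge : ∀ (m : Measure ℝ) [IsFiniteMeasure m],
      IntegrableOn (fun z => F (x + z) (x + z) - F (x + z) (y + z)) (Ioi 0) m := by
    intro m _
    refine ((hφ.integrableOn_shift hx).const_mul (-f (x - y))).congr (.of_forall fun z => ?_)
    simp only
    rw [F_diag_eq hF, F_shift_eq hF hxy]; ring
  refine ⟨?_, ?_, ?_, lasso _, merge _, lasso _, merge _⟩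
  · refine ((hφ.integrableOn_increment hνw hx).const_mul (f (x - y))).congr
      (.of_forall fun z => ?_)
    simp only
    rw [F_shift_eq hF hxy, F_eq hF hxy]; ring
  · refine (integrableOn_product_increment hφ hf hμw hx hu.le).congr_fun (fun z hz => ?_)
      measurableSet_Ioi
    simp only
    rw [F_first_eq hF hxy (le_of_lt hz), F_eq hF hxy, Fx_eq hf1 hφ1 hF hxy.ne']
  · refine ((hφ.integrableOn_compensated hμw hx).const_mul (f (x - y))).congr
      (.of_forall fun z => ?_)
    simp only
    rw [F_shift_eq hF hxy, F_eq hF hxy, Fx_eq hf1 hφ1 hF hxy.ne', Fy_eq hf1 hF hxy.ne']; ring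

/-! ### Comparison of the individual terms -/

theorem setIntegral_product_increment_le {φ f : ℝ → ℝ} {M N : ℝ} (hφ : BoundedCTwo φ M)
    (hf : BoundedCTwo f N) (hφa : AntitoneOn φ (Ici 0)) (hfm : MonotoneOn f (Ici 0))
    {m : Measure ℝ} (hm : IntegrableOn (fun z => min 1 (z ^ 2)) (Ioi 0) m)
    {x u : ℝ} (hx : 0 ≤ x) (hu : 0 ≤ u) :
    ∫ z in Ioi (0 : ℝ), (φ (x + z) * f (u + z) - φ x * f u
        - (deriv φ x * f u + φ x * deriv f u) * cutoff z) ∂m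
      ≤ f u * (∫ z in Ioi (0 : ℝ), (φ (x + z) - φ x - deriv φ x * cutoff z) ∂m)
        + φ x * ∫ z in Ioi (0 : ℝ), (f (u + z) - f u - deriv f u * cutoff z) ∂m := by
  have h1 := (hφ.integrableOn_compensated hm hx).const_mul (f u)
  have h2 := (hf.integrableOn_compensated hm hu).const_mul (φ x)
  rw [← integral_const_mul, ← integral_const_mul, ← integral_add h1 h2]
  refine setIntegral_mono_on (integrableOn_product_increment hφ hf hm hx hu) (h1.add h2)
    measurableSet_Ioi fun z hz => ?_
  have hz : 0 < z := hz
  rw [product_increment_eq]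
  have hφz : φ (x + z) ≤ φ x := hφa hx (mem_Ici.2 (by linarith)) (by linarith)
  have hfz : f u ≤ f (u + z) := hfm hu (mem_Ici.2 (by linarith)) (by linarith)
  nlinarith

theorem setIntegral_shift_le {φ : ℝ → ℝ} {M : ℝ} (hφ : BoundedCTwo φ M)
    (hφa : AntitoneOn φ (Ici 0)) {m : Measure ℝ} [IsFiniteMeasure m] {x : ℝ} (hx : 0 ≤ x) :
    ∫ z in Ioi (0 : ℝ), φ (x + z) ∂m ≤ φ x * (m (Ioi 0)).toReal := by
  calc _ ≤ ∫ z in Ioi (0 : ℝ), φ x ∂m :=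
        setIntegral_mono_on (hφ.integrableOn_shift hx) (integrable_const _) measurableSet_Ioi
          fun z (hz : 0 < z) => hφa hx (mem_Ici.2 (by linarith)) (by linarith)
    _ = _ := by rw [setIntegral_const, smul_eq_mul, mul_comm]; rfl

theorem setIntegral_shift_eq {φ : ℝ → ℝ} {M : ℝ} (hφ : BoundedCTwo φ M)
    {m : Measure ℝ} [IsFiniteMeasure m] {x : ℝ} (hx : 0 ≤ x) :
    ∫ z in Ioi (0 : ℝ), φ (x + z) ∂m
      = (∫ z in Ioi (0 : ℝ), (φ (x + z) - φ x) ∂m) + φ x * (m (Ioi 0)).toReal := by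
  rw [integral_sub (hφ.integrableOn_shift hx) (integrable_const _), setIntegral_const,
    smul_eq_mul, Measure.real]
  ring

theorem setIntegral_sub_measure {h : ℝ → ℝ} {s : Set ℝ} {m n : Measure ℝ} [IsFiniteMeasure n]
    (hnm : n ≤ m) (hh : IntegrableOn h s m) :
    ∫ z in s, h z ∂(m - n) = ∫ z in s, h z ∂m - ∫ z in s, h z ∂n := by
  have e : (m - n).restrict s + n.restrict s = m.restrict s := by
    rw [← Measure.restrict_add, Measure.sub_add_cancel_of_le hnm]
  rw [← e, integral_add_measure (hh.mono_measure Measure.sub_le) (hh.mono_measure hnm)]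
  ring

theorem deriv_deriv_nonpos_of_concaveOn_Ici {h : ℝ → ℝ} (hh : ConcaveOn ℝ (Ici 0) h)
    (hd : Differentiable ℝ h) {u : ℝ} (hu : 0 < u) : deriv (deriv h) u ≤ 0 :=
  deriv_nonpos_of_antitoneOn_Ici (hh.antitoneOn_deriv fun x _ => hd x) hu

end CouplingEstimate

/- Lemma 4.2 of Li–Li–Wang–Zhou: for `f ∈ C_b²([0,∞))` nonnegative, concave and
nondecreasing and `φ ∈ C_b²([0,∞))` nonnegative and nonincreasing, the function
`F(x,y) = φ(x) f(x−y) 1_{x≠y}` belongs to the domain of the coupling generator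
`L̃`, and on `Δᶜ`,
`L̃F(x,y) ≤ cyφ(x)f″(x−y) + [β−bx−g(x)]φ′(x)f(x−y)
  + yφ(x)[f(2(x−y)) − 2f(x−y)] μ_{x−y}(0,∞)
  + φ(x)[f(2(x−y)) − 2f(x−y)] ν_{x−y}(0,∞) + Ã₁F(x,y) + Ã₂F(x,y)`. -/
theorem coupling_generator_estimate
    (b c β : ℝ) (hc : 0 ≤ c) (hβ : 0 ≤ β)
    (μ ν : Measure ℝ)
    (hμsupp : μ (Set.Iic 0) = 0) (hνsupp : ν (Set.Iic 0) = 0)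
    (hμloc : ∫⁻ z, ENNReal.ofReal (min 1 (z ^ 2)) ∂μ < ⊤)
    (hνloc : ∫⁻ z, ENNReal.ofReal (min 1 z) ∂ν < ⊤)
    (g : ℝ → ℝ) (hg0 : g 0 = 0) (hgmono : MonotoneOn g (Set.Ici 0))
    (hgcont : ContinuousOn g (Set.Ici 0)) (hgnonneg : ∀ x ∈ Set.Ici (0 : ℝ), 0 ≤ g x)
    (f φ : ℝ → ℝ) (hf : ContDiff ℝ 2 f) (hφ : ContDiff ℝ 2 φ)
    (hfbdd : ∃ M : ℝ, ∀ x ∈ Set.Ici (0 : ℝ),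
      |f x| + |deriv f x| + |deriv (deriv f) x| ≤ M)
    (hφbdd : ∃ M : ℝ, ∀ x ∈ Set.Ici (0 : ℝ),
      |φ x| + |deriv φ x| + |deriv (deriv φ) x| ≤ M)
    (hfnonneg : ∀ x ∈ Set.Ici (0 : ℝ), 0 ≤ f x)
    (hfconc : ConcaveOn ℝ (Set.Ici 0) f) (hfmono : MonotoneOn f (Set.Ici 0))
    (hφnonneg : ∀ x ∈ Set.Ici (0 : ℝ), 0 ≤ φ x) (hφanti : AntitoneOn φ (Set.Ici 0))
    (F : ℝ → ℝ → ℝ) (hF : F = fun x y => if x = y then 0 else φ x * f (x - y)) :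
    InDomLtil b c β g μ ν F ∧
    ∀ x y : ℝ, 0 ≤ y → y < x →
      Ltil b c β g μ ν F x y ≤
        c * y * φ x * deriv (deriv f) (x - y)
          + (β - b * x - g x) * deriv φ x * f (x - y)
          + y * φ x * (f (2 * (x - y)) - 2 * f (x - y))
              * ((mShift μ (x - y)) (Set.Ioi 0)).toReal
          + φ x * (f (2 * (x - y)) - 2 * f (x - y))
              * ((mShift ν (x - y)) (Set.Ioi 0)).toReal
          + f (x - y) * (c * x * deriv (deriv φ) x
              - y * (∫ z in Set.Ioi (0 : ℝ), (φ (x + z) - φ x) ∂(mShift μ (y - x)))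
              + x * (∫ z in Set.Ioi (0 : ℝ), (φ (x + z) - φ x - deriv φ x * cutoff z) ∂μ)
              + (∫ z in Set.Ioi (0 : ℝ), (φ (x + z) - φ x) ∂(ν - mShift ν (y - x))))
          + (x - y) * φ x * (c * deriv (deriv f) (x - y) - b * deriv f (x - y)
              + (∫ z in Set.Ioi (0 : ℝ),
                  (f (x - y + z) - f (x - y) - deriv f (x - y) * cutoff z) ∂μ)) := by
  have hμw := integrableOn_of_lintegral_ofReal (by fun_prop) (fun z _ => by positivity) hμloc
  have hνw := integrableOn_of_lintegral_ofReal (by fun_prop)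
    (fun z hz => le_min zero_le_one hz.le) hνloc
  have hμt : ∀ u, 0 < u → μ (Set.Ioi u) < ⊤ := fun u hu =>
    measure_Ioi_lt_top hμw (fun s hs t _ hst =>
      min_le_min_left _ (pow_le_pow_left₀ (le_of_lt hs) hst 2)) hu (by positivity)
  have hνt : ∀ u, 0 < u → ν (Set.Ioi u) < ⊤ := fun u hu =>
    measure_Ioi_lt_top hνw (fun s _ t _ hst => min_le_min_left _ hst) hu (by positivity)
  obtain ⟨N, hfN⟩ := BoundedCTwo.of_exists hf hfbdd
  obtain ⟨M, hφM⟩ := BoundedCTwo.of_exists hφ hφbdd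
  refine ⟨inDomLtil_product hμsupp hνsupp hμw hνw hμt hνt hgcont hfN hφM hF, ?_⟩
  intro x y hy hxy
  have hx : 0 < x := hy.trans_lt hxy
  have hu : 0 < x - y := sub_pos.2 hxy
  rw [Ltil_eq hf hφ hF hxy, ← neg_sub x y]
  have := isFiniteMeasure_mShift hμsupp hμt hu
  have := isFiniteMeasure_mShift_neg hμsupp hμt hu
  have := isFiniteMeasure_mShift hνsupp hνt hu
  have := isFiniteMeasure_mShift_neg hνsupp hνt hu
  rw [setIntegral_sub_measure (mShift_le ν _) (hφM.integrableOn_increment hνw hx.le),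
    setIntegral_shift_eq hφM (m := mShift μ (-(x - y))) hx.le,
    setIntegral_shift_eq hφM (m := mShift ν (-(x - y))) hx.le]
  have hprod := setIntegral_product_increment_le hφM hfN hφanti hfmono hμw hx.le hu.le
  have hSμ := setIntegral_shift_le hφM hφanti (m := mShift μ (x - y)) hx.le
  have hSν := setIntegral_shift_le hφM hφanti (m := mShift ν (x - y)) hx.le
  have hmμ := ENNReal.toReal_mono (measure_ne_top _ _) (mShift_Ioi_le hμsupp (x - y))
  have hmν := ENNReal.toReal_mono (measure_ne_top _ _) (mShift_Ioi_le hνsupp (x - y))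
  have hφ0 : 0 ≤ φ x := hφnonneg x hx.le
  have hφ1 : deriv φ x ≤ 0 := deriv_nonpos_of_antitoneOn_Ici hφanti hx
  have hf0 : 0 ≤ f (x - y) := hfnonneg _ hu.le
  have hf1 : 0 ≤ deriv f (x - y) := deriv_nonneg_of_monotoneOn_Ici hfmono hu
  have hf2 : deriv (deriv f) (x - y) ≤ 0 :=
    deriv_deriv_nonpos_of_concaveOn_Ici hfconc hfN.differentiable hu
  have hfd : 0 ≤ f (2 * (x - y)) - f (x - y) := sub_nonneg.2 <|
    hfmono hu.le (Set.mem_Ici.2 (by linarith)) (by linarith)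
  have hgxy : 0 ≤ g x - g y := sub_nonneg.2 (hgmono hy hx.le hxy.le)
  have t1 := mul_nonneg hgxy (mul_nonneg hφ0 hf1)
  have t2 := mul_nonneg (mul_nonneg hc (add_nonneg hx.le hy)) (mul_nonneg (neg_nonneg.2 hφ1) hf1)
  have t3 := mul_nonneg (mul_nonneg hc hy) (mul_nonneg hφ0 (neg_nonneg.2 hf2))
  have t4 := mul_nonneg hu.le (sub_nonneg.2 hprod)
  have t5 := mul_nonneg hy (mul_nonneg hfd (sub_nonneg.2 hSμ))
  have t6 := mul_nonneg (mul_nonneg hy (mul_nonneg hf0 hφ0)) (sub_nonneg.2 hmμ)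
  have t7 := mul_nonneg hfd (sub_nonneg.2 hSν)
  have t8 := mul_nonneg (mul_nonneg hf0 hφ0) (sub_nonneg.2 hmν)
  linarith
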